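/- Let N ≥ 2 and let V be a unitary on ℂ^N ⊗ ℂ^N. If g_t(V²) < g_t(V)·(2 − g_t(V)), then there exist unitaries U^A, U^B on ℂ^N such that g_t(V²) < g_t(V·(U^A ⊗ U^B)·V). -/

import Mathlib

open Matrix MeasureTheory
open scoped Kronecker

noncomputable section

instance {m n R : Type*} [TopologicalSpace R] : MeasurableSpace (Matrix m n R) := borel _
instance {m n R : Type*} [TopologicalSpace R] : BorelSpace (Matrix m n R) := ⟨rfl⟩

/-- Reshuffling: `(U_R)_{(i,j),(α,β)} = U_{(i,α),(j,β)}`. -/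
def reshuffle (N : ℕ) (U : Matrix (Fin N × Fin N) (Fin N × Fin N) ℂ) :
    Matrix (Fin N × Fin N) (Fin N × Fin N) ℂ :=
  Matrix.of fun p q => U (p.1, q.1) (p.2, q.2)

/-- Partial transpose: `(U_Γ)_{(j,α),(i,β)} = U_{(i,α),(j,β)}`. -/
def ptransp (N : ℕ) (U : Matrix (Fin N × Fin N) (Fin N × Fin N) ℂ) :
    Matrix (Fin N × Fin N) (Fin N × Fin N) ℂ :=
  Matrix.of fun p q => U (q.1, p.2) (p.1, q.2)

/-- The swap gate `S(x ⊗ y) = y ⊗ x`. -/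
def swapGate (N : ℕ) : Matrix (Fin N × Fin N) (Fin N × Fin N) ℂ :=
  Matrix.of fun p q => if p.1 = q.2 ∧ p.2 = q.1 then 1 else 0

/-- `ρ_R(U) = U_R U_R† / N²`. -/
def rhoR (N : ℕ) (U : Matrix (Fin N × Fin N) (Fin N × Fin N) ℂ) :
    Matrix (Fin N × Fin N) (Fin N × Fin N) ℂ :=
  ((N : ℂ) ^ 2)⁻¹ • (reshuffle N U * (reshuffle N U)ᴴ)

/-- `ρ_T(U) = S U_Γ U_Γ† S / N²`. -/
def rhoT (N : ℕ) (U : Matrix (Fin N × Fin N) (Fin N × Fin N) ℂ) :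
    Matrix (Fin N × Fin N) (Fin N × Fin N) ℂ :=
  ((N : ℂ) ^ 2)⁻¹ • (swapGate N * (ptransp N U * (ptransp N U)ᴴ) * swapGate N)

/-- Purity `X(U) = tr(ρ_R(U)²)` (a real number). -/
def Xpur (N : ℕ) (U : Matrix (Fin N × Fin N) (Fin N × Fin N) ℂ) : ℝ :=
  ((rhoR N U * rhoR N U).trace).re

/-- Purity `Y(U) = tr(ρ_T(U)²)` (a real number). -/
def Ypur (N : ℕ) (U : Matrix (Fin N × Fin N) (Fin N × Fin N) ℂ) : ℝ :=
  ((rhoT N U * rhoT N U).trace).re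

/-- Entangling power `e_p(U)`. -/
def ep (N : ℕ) (U : Matrix (Fin N × Fin N) (Fin N × Fin N) ℂ) : ℝ :=
  ((N : ℝ) ^ 2 / ((N : ℝ) + 1) ^ 2) *
    ((1 - Xpur N U) + (1 - Ypur N U) - ((N : ℝ) ^ 2 - 1) / (N : ℝ) ^ 2)

/-- Gate typicality `g_t(U)`. -/
def gateTyp (N : ℕ) (U : Matrix (Fin N × Fin N) (Fin N × Fin N) ℂ) : ℝ :=
  ((N : ℝ) ^ 2 / ((N : ℝ) ^ 2 - 1)) *
    (Ypur N U - Xpur N U + ((N : ℝ) ^ 2 - 1) / (N : ℝ) ^ 2)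

/-- Mean entangling power over the Haar measure, `ē_p = (N-1)²/(N²+1)`. -/
def epBar (N : ℕ) : ℝ := ((N : ℝ) - 1) ^ 2 / ((N : ℝ) ^ 2 + 1)

/-- `iterGate U W k = U · W_{k-1} · U ⋯ W_0 · U`, i.e. `U^(k+1)` with `k` interlacing
local gates `W_0, …, W_{k-1}`. -/
def iterGate {D : Type*} [Fintype D] [DecidableEq D] (U : Matrix D D ℂ)
    (W : ℕ → Matrix D D ℂ) : ℕ → Matrix D D ℂ
  | 0 => U
  | k + 1 => U * W k * iterGate U W k

section Commutant

variable {n : ℕ}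

/-- The entrywise form of commuting with `E_{ab} ⊗ 1 + 1 ⊗ E_{ab}` for all `a b`. -/
def CommutesWithUnits (Q : Fin n → Fin n → Fin n → Fin n → ℂ) : Prop :=
  ∀ a b i j k l, (if b = k then Q i j a l else 0) + (if b = l then Q i j k a else 0) =
    (if i = a then Q b j k l else 0) + (if j = a then Q i b k l else 0)

theorem CommutesWithUnits.exists_eq {Q : Fin n → Fin n → Fin n → Fin n → ℂ}
    (hn : 2 ≤ n) (hQ : CommutesWithUnits Q) :
    ∃ x y : ℂ, ∀ i j k l, Q i j k l =
      (if i = k ∧ j = l then x else 0) + (if i = l ∧ j = k then y else 0) := by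
  have hn0 : (n : ℂ) ≠ 0 := by
    have : n ≠ 0 := by omega
    exact_mod_cast this
  have hn1 : (n : ℂ) ^ 2 - 1 ≠ 0 := by
    rw [sub_ne_zero]
    have : n ^ 2 ≠ 1 := by nlinarith
    exact_mod_cast this
  set R : Fin n → Fin n → ℂ := fun j l => ∑ k, Q k j k l with hR
  set R' : Fin n → Fin n → ℂ := fun i l => ∑ k, Q i k k l with hR'
  have hRs : ∀ j a, R j a = if j = a then (∑ b, R b b) / n else 0 := by
    intro j a
    have h1 : ∀ b l, (if b = l then R j a else 0) = if j = a then R b l else 0 := by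
      intro b l
      have h2 := Finset.sum_congr (rfl : (Finset.univ : Finset (Fin n)) = Finset.univ)
        fun i _ => hQ a b i j i l
      simp only [Finset.sum_add_distrib, Finset.sum_ite_eq, Finset.sum_ite_eq', Finset.mem_univ,
        if_true, Finset.sum_ite_irrel, Finset.sum_const_zero] at h2
      exact add_left_cancel h2
    have h3 := Finset.sum_congr (rfl : (Finset.univ : Finset (Fin n)) = Finset.univ)
        fun b _ => h1 b b
    simp only [if_true, Finset.sum_const, Finset.card_univ, Fintype.card_fin, nsmul_eq_mul,
      Finset.sum_ite_irrel] at h3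
    split_ifs with h
    · rw [if_pos h] at h3
      field_simp
      linear_combination h3
    · rw [if_neg h, mul_zero] at h3
      exact (mul_eq_zero.mp h3).resolve_left hn0
  have hRs' : ∀ i a, R' i a = if i = a then (∑ b, R' b b) / n else 0 := by
    intro i a
    have h1 : ∀ b l, (if b = l then R' i a else 0) = if i = a then R' b l else 0 := by
      intro b l
      have h2 := Finset.sum_congr (rfl : (Finset.univ : Finset (Fin n)) = Finset.univ)
        fun j _ => hQ a b i j j l
      simp only [Finset.sum_add_distrib, Finset.sum_ite_eq, Finset.sum_ite_eq', Finset.mem_univ,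
        if_true, Finset.sum_ite_irrel, Finset.sum_const_zero] at h2
      rw [add_comm] at h2
      exact add_right_cancel h2
    have h3 := Finset.sum_congr (rfl : (Finset.univ : Finset (Fin n)) = Finset.univ)
        fun b _ => h1 b b
    simp only [if_true, Finset.sum_const, Finset.card_univ, Fintype.card_fin, nsmul_eq_mul,
      Finset.sum_ite_irrel] at h3
    split_ifs with h
    · rw [if_pos h] at h3
      field_simp
      linear_combination h3
    · rw [if_neg h, mul_zero] at h3
      exact (mul_eq_zero.mp h3).resolve_left hn0
  have hmain : ∀ i j a l, n * Q i j a l + Q i j l a =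
      (if i = a then R j l else 0) + (if j = a then R' i l else 0) := by
    intro i j a l
    have h2 := Finset.sum_congr (rfl : (Finset.univ : Finset (Fin n)) = Finset.univ)
        fun b _ => hQ a b i j b l
    simpa only [Finset.sum_add_distrib, Finset.sum_ite_eq, Finset.sum_ite_eq', Finset.mem_univ,
      if_true, Finset.sum_ite_irrel, Finset.sum_const_zero, Finset.sum_const, Finset.card_univ,
      Fintype.card_fin, nsmul_eq_mul] using h2
  generalize (∑ b, R b b) / n = r at hRs
  generalize (∑ b, R' b b) / n = r' at hRs'
  refine ⟨(n * r - r') / (n ^ 2 - 1), (n * r' - r) / (n ^ 2 - 1), fun i j k l => ?_⟩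
  have h1 := hmain i j k l
  have h2 := hmain i j l k
  rw [hRs, hRs'] at h1 h2
  have h3 : ((n : ℂ) ^ 2 - 1) * Q i j k l =
      n * ((if i = k then if j = l then r else 0 else 0) +
        (if j = k then if i = l then r' else 0 else 0)) -
      ((if i = l then if j = k then r else 0 else 0) +
        (if j = l then if i = k then r' else 0 else 0)) := by
    rw [← h1, ← h2]; ring
  rw [← mul_right_inj' hn1, h3]
  simp only [ite_and]
  split_ifs <;> (try field_simp) <;> ring

end Commutant

section FixedPoint

theorem exists_fixed_mem_closedConvexHull {E : Type*} [NormedAddCommGroup E]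
    [InnerProductSpace ℝ E] [CompleteSpace E] (G : Set (E →ₗᵢ[ℝ] E)) {O : Set E}
    (hne : O.Nonempty) (hO : ∀ g ∈ G, ∀ x ∈ O, g x ∈ O) :
    ∃ P ∈ closedConvexHull ℝ O, ∀ g ∈ G, g P = P := by
  have hcl : IsClosed (closedConvexHull ℝ O : Set E) := isClosed_closedConvexHull
  have hcv : Convex ℝ (closedConvexHull ℝ O : Set E) := convex_closedConvexHull
  have hsub : O ⊆ closedConvexHull ℝ O := subset_closedConvexHull
  obtain ⟨P, hP, hmin⟩ := exists_norm_eq_iInf_of_complete_convex (hne.mono hsub)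
    hcl.isComplete hcv 0
  have hinner := (norm_eq_iInf_iff_real_inner_le_zero hcv hP).mp hmin
  refine ⟨P, hP, fun g hg => ?_⟩
  have hgP : g P ∈ closedConvexHull ℝ O := by
    have : closedConvexHull ℝ O ⊆ g ⁻¹' (closedConvexHull ℝ O) :=
      closedConvexHull_min (fun x hx => hsub (hO g hg x hx))
        (hcv.linear_preimage g.toLinearMap) (hcl.preimage g.continuous)
    exact this hP
  have h1 := hinner _ hgP
  have h2 := g.norm_map P
  have h3 := norm_sub_sq_real (g P) P
  rw [zero_sub, inner_neg_left, inner_sub_right, real_inner_self_eq_norm_sq,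
    real_inner_comm] at h1
  rw [h2] at h3
  have h4 : ‖g P - P‖ ^ 2 ≤ 0 := by linarith
  rw [← sub_eq_zero, ← norm_eq_zero]
  exact pow_eq_zero_iff two_ne_zero |>.mp (le_antisymm h4 (sq_nonneg _))

variable {ι : Type*} [Fintype ι]

/-- Matrices, seen as a real Hilbert space with the Frobenius norm. -/
def matrixToEuclidean : Matrix ι ι ℂ ≃ₗ[ℝ] EuclideanSpace ℂ (ι × ι) :=
  (LinearEquiv.curry ℝ ℂ ι ι).symm.trans (WithLp.linearEquiv 2 ℝ (ι × ι → ℂ)).symm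

theorem norm_sq_matrixToEuclidean (A : Matrix ι ι ℂ) :
    ‖matrixToEuclidean A‖ ^ 2 = ((A * Aᴴ).trace).re := by
  rw [EuclideanSpace.norm_sq_eq, Fintype.sum_prod_type]
  simp only [Matrix.trace, Matrix.diag, Matrix.mul_apply, Matrix.conjTranspose_apply,
    Complex.re_sum]
  refine Finset.sum_congr rfl fun i _ => Finset.sum_congr rfl fun j _ => ?_
  change ‖A i j‖ ^ 2 = _
  simp [Complex.sq_norm, Complex.normSq_apply]

variable [DecidableEq ι]

/-- Conjugation by a unitary matrix, as an isometry for the Frobenius norm. -/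
def conjIsometry (W : Matrix ι ι ℂ) (hW : Wᴴ * W = 1) :
    EuclideanSpace ℂ (ι × ι) →ₗᵢ[ℝ] EuclideanSpace ℂ (ι × ι) where
  toLinearMap := matrixToEuclidean.toLinearMap ∘ₗ
    ((LinearMap.mulRight ℝ Wᴴ) ∘ₗ (LinearMap.mulLeft ℝ W)) ∘ₗ matrixToEuclidean.symm.toLinearMap
  norm_map' x := by
    obtain ⟨A, rfl⟩ := matrixToEuclidean.surjective x
    have key : ‖matrixToEuclidean (W * A * Wᴴ)‖ ^ 2 = ‖matrixToEuclidean A‖ ^ 2 := by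
      rw [norm_sq_matrixToEuclidean, norm_sq_matrixToEuclidean]
      congr 1
      rw [Matrix.conjTranspose_mul, Matrix.conjTranspose_mul, Matrix.conjTranspose_conjTranspose,
        show W * A * Wᴴ * (W * (Aᴴ * Wᴴ)) = W * (A * (Wᴴ * W) * Aᴴ * Wᴴ) by
          simp only [Matrix.mul_assoc], hW, Matrix.mul_one, Matrix.trace_mul_comm,
        Matrix.mul_assoc, hW, Matrix.mul_one]
    simpa using (sq_eq_sq₀ (norm_nonneg _) (norm_nonneg _)).mp key

/-- A conjugation-invariant matrix obtained by averaging `B` over a monoid of unitaries. -/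
theorem exists_conj_invariant (G : Submonoid (Matrix ι ι ℂ))
    (hG : ∀ W ∈ G, Wᴴ * W = 1) (B : Matrix ι ι ℂ) :
    ∃ P : Matrix ι ι ℂ, (∀ W ∈ G, W * P * Wᴴ = P) ∧
      ∀ (f : Matrix ι ι ℂ →ₗ[ℝ] ℝ) (c : ℝ), (∀ W ∈ G, c ≤ f (W * B * Wᴴ)) → c ≤ f P := by
  obtain ⟨P, hP, hfix⟩ := exists_fixed_mem_closedConvexHull
    {g | ∃ W, ∃ hW : W ∈ G, g = conjIsometry W (hG W hW)}
    (O := {x | ∃ W ∈ G, x = matrixToEuclidean (W * B * Wᴴ)}) ⟨_, 1, G.one_mem, rfl⟩ (by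
      rintro _ ⟨W, hW, rfl⟩ _ ⟨W', hW', rfl⟩
      refine ⟨W * W', G.mul_mem hW hW', ?_⟩
      simp [conjIsometry, Matrix.mul_assoc])
  refine ⟨matrixToEuclidean.symm P, fun W hW => ?_, fun f c hf => ?_⟩
  · have := hfix _ ⟨W, hW, rfl⟩
    rw [← matrixToEuclidean.injective.eq_iff, LinearEquiv.apply_symm_apply]
    exact this
  · let F : EuclideanSpace ℂ (ι × ι) →ₗ[ℝ] ℝ := f ∘ₗ matrixToEuclidean.symm.toLinearMap
    have hF : Continuous F := F.continuous_of_finiteDimensional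
    have : closedConvexHull ℝ {x | ∃ W ∈ G, x = matrixToEuclidean (W * B * Wᴴ)} ⊆
        {x | c ≤ F x} := by
      refine closedConvexHull_min ?_ (convex_halfSpace_ge F.isLinear c)
        (isClosed_le continuous_const hF)
      rintro _ ⟨W, hW, rfl⟩
      simpa [F] using hf W hW
    exact this hP

end FixedPoint

section Infinitesimal

theorem commute_add_of_isHermitian {n A : Type*} [Fintype n] [DecidableEq n] [Ring A]
    [Algebra ℂ A] {L R : Matrix n n ℂ →ₗ[ℂ] A} (hL : L 1 = 1) (hR : R 1 = 1) {P : A}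
    (h : ∀ u ∈ Matrix.unitaryGroup n ℂ, Commute P (L u * R u)) {p : Matrix n n ℂ}
    (hp : p.IsHermitian) {m : ℝ} (hm : m ≠ 0) (hpp : p * p = (m : ℂ) • p) :
    Commute P (L p + R p) := by
  have hmc : (m : ℂ) ≠ 0 := by exact_mod_cast hm
  have key : ∀ s : ℂ, s ≠ 0 → s + star s + star s * s * m = 0 →
      (P * (L p + R p) - (L p + R p) * P) + s • (P * (L p * R p) - L p * R p * P) = 0 := by
    intro s hs0 hs
    have hu : 1 + s • p ∈ Matrix.unitaryGroup n ℂ := by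
      have h0 : star (1 + s • p) * (1 + s • p) =
          1 + (s + star s + star s * s * m) • p := by
        rw [Matrix.star_eq_conjTranspose, Matrix.conjTranspose_add, Matrix.conjTranspose_smul,
          hp.eq, Matrix.conjTranspose_one]
        simp only [mul_add, add_mul, mul_one, one_mul, smul_mul_assoc, mul_smul_comm, hpp]
        module
      rw [Matrix.mem_unitaryGroup_iff', h0, hs, zero_smul, add_zero]
    have h1 := (h _ hu).eq
    simp only [map_add, map_smul, hL, hR, mul_add, add_mul, mul_one, one_mul, smul_mul_assoc,
      mul_smul_comm] at h1
    have h2 : s • ((P * (L p + R p) - (L p + R p) * P) +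
        s • (P * (L p * R p) - L p * R p * P)) = 0 := by
      rw [← sub_eq_zero] at h1
      rw [← h1]
      simp only [mul_add, add_mul]
      module
    exact (smul_eq_zero.mp h2).resolve_left hs0
  have k1 := key (-2 / m) (by simp [hmc]) (by
    simp only [Complex.star_def, map_div₀, map_neg, Complex.conj_ofReal, map_ofNat]
    field_simp
    ring)
  have k2 := key ((Complex.I - 1) / m) (by
      refine div_ne_zero (fun h0 => ?_) hmc
      simpa using congrArg Complex.im h0) (by
    simp only [Complex.star_def, map_div₀, map_sub, Complex.conj_I, Complex.conj_ofReal, map_one]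
    field_simp
    linear_combination -Complex.I_sq)
  have hI : Complex.I + 1 ≠ 0 := fun h0 => by simpa using congrArg Complex.im h0
  rw [Commute, SemiconjBy, ← sub_eq_zero]
  generalize P * (L p + R p) - (L p + R p) * P = c at *
  generalize P * (L p * R p) - L p * R p * P = d at *
  have h3 : (Complex.I + 1) • c = 0 := by
    have : (Complex.I + 1) • c = (Complex.I - 1) • (c + (-2 / m : ℂ) • d) +
        (2 : ℂ) • (c + ((Complex.I - 1) / m) • d) := by
      match_scalars <;> ring
    rw [this, k1, k2, smul_zero, smul_zero, add_zero]
  exact (smul_eq_zero.mp h3).resolve_left hI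

theorem commute_add_single {n A : Type*} [Fintype n] [DecidableEq n] [Ring A]
    [Algebra ℂ A] {L R : Matrix n n ℂ →ₗ[ℂ] A} (hL : L 1 = 1) (hR : R 1 = 1) {P : A}
    (h : ∀ u ∈ Matrix.unitaryGroup n ℂ, Commute P (L u * R u)) (a b : n) :
    Commute P (L (Matrix.single a b 1) + R (Matrix.single a b 1)) := by
  have hdiag : ∀ a, Commute P (L (Matrix.single a a 1) + R (Matrix.single a a 1)) := fun a =>
    commute_add_of_isHermitian hL hR h (m := 1) (by simp [Matrix.IsHermitian]) one_ne_zero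
      (by simp)
  by_cases hab : a = b
  · subst hab; exact hdiag a
  have hω : ∀ ω : ℂ, ω * star ω = 1 → Commute P
      (ω • (L (Matrix.single a b 1) + R (Matrix.single a b 1)) +
        star ω • (L (Matrix.single b a 1) + R (Matrix.single b a 1))) := by
    intro ω hω
    have h1 := commute_add_of_isHermitian hL hR h (m := 2)
      (p := Matrix.single a a 1 + Matrix.single b b 1 + Matrix.single a b ω +
        Matrix.single b a (star ω))
      (by
        simp only [Matrix.IsHermitian, Matrix.conjTranspose_add, Matrix.conjTranspose_single,
          star_star, star_one]
        abel) two_ne_zero (by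
        rw [Complex.ofReal_ofNat, two_smul]
        simp only [mul_add, add_mul, Matrix.single_mul_single_same, ne_eq, hab, Ne.symm hab,
          not_false_eq_true, Matrix.single_mul_single_of_ne, mul_one, one_mul, hω,
          mul_comm (star ω) ω]
        abel)
    have h2 := (h1.sub_right (hdiag a)).sub_right (hdiag b)
    have e1 : Matrix.single a b ω = ω • Matrix.single a b (1 : ℂ) := by simp
    have e2 : Matrix.single b a (star ω) = star ω • Matrix.single b a (1 : ℂ) := by simp
    rw [e1, e2] at h2
    simp only [map_add, map_smul] at h2
    convert h2 using 1
    module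
  have h1 := hω 1 (by simp)
  have h2 := hω Complex.I (by simp)
  have h3 := (h1.sub_right (h2.smul_right Complex.I)).smul_right (2⁻¹ : ℂ)
  convert h3 using 1
  simp only [star_one, Complex.star_def, Complex.conj_I]
  match_scalars <;> ring_nf <;> simp [Complex.I_sq] <;> norm_num

end Infinitesimal

section TwoCopies

variable {N : ℕ}

/-- Exchange of the first factors of two copies of `ℂ^N ⊗ ℂ^N`. -/
def exchangeA (N : ℕ) : Equiv.Perm ((Fin N × Fin N) × (Fin N × Fin N)) where
  toFun p := ((p.2.1, p.1.2), (p.1.1, p.2.2))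
  invFun p := ((p.2.1, p.1.2), (p.1.1, p.2.2))
  left_inv _ := rfl
  right_inv _ := rfl

/-- Exchange of the second factors of two copies of `ℂ^N ⊗ ℂ^N`. -/
def exchangeB (N : ℕ) : Equiv.Perm ((Fin N × Fin N) × (Fin N × Fin N)) where
  toFun p := ((p.1.1, p.2.2), (p.2.1, p.1.2))
  invFun p := ((p.1.1, p.2.2), (p.2.1, p.1.2))
  left_inv _ := rfl
  right_inv _ := rfl

/-- The operator exchanging the first factors of the two copies. -/
def opA (N : ℕ) : Matrix ((Fin N × Fin N) × (Fin N × Fin N)) ((Fin N × Fin N) × (Fin N × Fin N)) ℂ :=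
  (exchangeA N).toPEquiv.toMatrix

/-- The operator exchanging the second factors of the two copies. -/
def opB (N : ℕ) : Matrix ((Fin N × Fin N) × (Fin N × Fin N)) ((Fin N × Fin N) × (Fin N × Fin N)) ℂ :=
  (exchangeB N).toPEquiv.toMatrix

/-- The operator exchanging the two copies. -/
def opS (N : ℕ) : Matrix ((Fin N × Fin N) × (Fin N × Fin N)) ((Fin N × Fin N) × (Fin N × Fin N)) ℂ :=
  (Equiv.prodComm (Fin N × Fin N) (Fin N × Fin N)).toPEquiv.toMatrix

theorem opA_apply (p q : (Fin N × Fin N) × (Fin N × Fin N)) :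
    opA N p q = if exchangeA N p = q then 1 else 0 := by
  simp [opA, PEquiv.toMatrix_apply]

theorem opB_apply (p q : (Fin N × Fin N) × (Fin N × Fin N)) :
    opB N p q = if exchangeB N p = q then 1 else 0 := by
  simp [opB, PEquiv.toMatrix_apply]

theorem opS_apply (p q : (Fin N × Fin N) × (Fin N × Fin N)) :
    opS N p q = if p.swap = q then 1 else 0 := by
  simp [opS, PEquiv.toMatrix_apply]

theorem opA_mul_opA : opA N * opA N = 1 := by
  rw [opA, ← PEquiv.toMatrix_trans, ← Equiv.toPEquiv_trans]
  exact PEquiv.toMatrix_refl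

theorem opS_mul_opA : opS N * opA N = opB N := by
  rw [opS, opA, ← PEquiv.toMatrix_trans, ← Equiv.toPEquiv_trans]
  rfl

theorem opA_mul_opS : opA N * opS N = opB N := by
  rw [opS, opA, ← PEquiv.toMatrix_trans, ← Equiv.toPEquiv_trans]
  rfl

theorem opB_mul_opS : opB N * opS N = opA N := by
  rw [opS, opB, ← PEquiv.toMatrix_trans, ← Equiv.toPEquiv_trans]
  rfl

theorem opA_mul_opB : opA N * opB N = opS N := by
  rw [opS, opA, opB, ← PEquiv.toMatrix_trans, ← Equiv.toPEquiv_trans]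
  rfl

theorem opB_mul_opA : opB N * opA N = opS N := by
  rw [opS, opA, opB, ← PEquiv.toMatrix_trans, ← Equiv.toPEquiv_trans]
  rfl

theorem opB_mul_opB : opB N * opB N = 1 := by
  rw [opB, ← PEquiv.toMatrix_trans, ← Equiv.toPEquiv_trans]
  exact PEquiv.toMatrix_refl

theorem conjTranspose_opA : (opA N)ᴴ = opA N :=
  Matrix.conjTranspose_permMatrix (exchangeA N)

theorem conjTranspose_opB : (opB N)ᴴ = opB N :=
  Matrix.conjTranspose_permMatrix (exchangeB N)

theorem opS_mul_kronecker_self (U : Matrix (Fin N × Fin N) (Fin N × Fin N) ℂ) :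
    opS N * (U ⊗ₖ U) = (U ⊗ₖ U) * opS N := by
  rw [opS, PEquiv.toMatrix_toPEquiv_mul, PEquiv.mul_toMatrix_toPEquiv]
  ext p q
  exact mul_comm _ _

theorem opA_mul_local (a b : Matrix (Fin N) (Fin N) ℂ) :
    opA N * ((a ⊗ₖ b) ⊗ₖ (a ⊗ₖ b)) = ((a ⊗ₖ b) ⊗ₖ (a ⊗ₖ b)) * opA N := by
  rw [opA, PEquiv.toMatrix_toPEquiv_mul, PEquiv.mul_toMatrix_toPEquiv]
  ext p q
  simp [exchangeA]
  ring

theorem opB_mul_local (a b : Matrix (Fin N) (Fin N) ℂ) :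
    opB N * ((a ⊗ₖ b) ⊗ₖ (a ⊗ₖ b)) = ((a ⊗ₖ b) ⊗ₖ (a ⊗ₖ b)) * opB N := by
  rw [← opS_mul_opA, Matrix.mul_assoc, opA_mul_local, ← Matrix.mul_assoc,
    opS_mul_kronecker_self, Matrix.mul_assoc]

theorem trace_opA : (opA N).trace = (N : ℂ) ^ 3 := by
  simp [Matrix.trace, opA_apply, exchangeA, Fintype.sum_prod_type, Prod.ext_iff, ite_and]
  ring

theorem trace_opB : (opB N).trace = (N : ℂ) ^ 3 := by
  simp [Matrix.trace, opB_apply, exchangeB, Fintype.sum_prod_type, Prod.ext_iff, ite_and]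
  ring

theorem trace_opS : (opS N).trace = (N : ℂ) ^ 2 := by
  simp [Matrix.trace, opS_apply, Fintype.sum_prod_type, Prod.ext_iff, ite_and]
  ring

theorem trace_gram_sq {m n : Type*} [Fintype m] [Fintype n] (R : Matrix m n ℂ) :
    (R * Rᴴ * (R * Rᴴ)).trace =
      ∑ x : m × m × n × n, R x.1 x.2.2.1 * star (R x.2.1 x.2.2.1) *
        (R x.2.1 x.2.2.2 * star (R x.1 x.2.2.2)) := by
  simp only [Matrix.trace, Matrix.diag, Matrix.mul_apply, Matrix.conjTranspose_apply,
    Fintype.sum_prod_type, Finset.sum_mul_sum]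

theorem trace_exchange_conj {ι : Type*} [Fintype ι] [DecidableEq ι] (σ τ : Equiv.Perm ι)
    (K : Matrix ι ι ℂ) :
    ((σ.toPEquiv.toMatrix : Matrix ι ι ℂ) * K * τ.toPEquiv.toMatrix * Kᴴ).trace =
      ∑ x : ι × ι, K (σ x.1) (τ.symm x.2) * star (K x.1 x.2) := by
  rw [PEquiv.toMatrix_toPEquiv_mul, PEquiv.mul_toMatrix_toPEquiv, Fintype.sum_prod_type]
  simp [Matrix.trace, Matrix.mul_apply]

/-- Regrouping the indices of the four factors in `tr((U_R U_R†)²)`. -/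
def regroupR (ι : Type*) : (ι × ι) × (ι × ι) × (ι × ι) × (ι × ι) ≃
    ((ι × ι) × (ι × ι)) × ((ι × ι) × (ι × ι)) where
  toFun x := (((x.2.1.1, x.2.2.1.1), (x.1.1, x.2.2.2.1)), ((x.2.1.2, x.2.2.1.2), (x.1.2, x.2.2.2.2)))
  invFun y := ((y.1.2.1, y.2.2.1), (y.1.1.1, y.2.1.1), (y.1.1.2, y.2.1.2), (y.1.2.2, y.2.2.2))
  left_inv _ := rfl
  right_inv _ := rfl

/-- Regrouping the indices of the four factors in `tr((U_Γ U_Γ†)²)`. -/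
def regroupT (ι : Type*) : (ι × ι) × (ι × ι) × (ι × ι) × (ι × ι) ≃
    ((ι × ι) × (ι × ι)) × ((ι × ι) × (ι × ι)) where
  toFun x := (((x.2.2.1.1, x.2.1.2), (x.2.2.2.1, x.1.2)), ((x.2.1.1, x.2.2.1.2), (x.1.1, x.2.2.2.2)))
  invFun y := ((y.2.2.1, y.1.2.2), (y.2.1.1, y.1.1.2), (y.1.1.1, y.2.1.2), (y.1.2.1, y.2.2.2))
  left_inv _ := rfl
  right_inv _ := rfl

theorem trace_opA_conj (hN : N ≠ 0) (U : Matrix (Fin N × Fin N) (Fin N × Fin N) ℂ) :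
    (opA N * (U ⊗ₖ U) * opA N * (U ⊗ₖ U)ᴴ).trace = (N : ℂ) ^ 4 * (rhoR N U * rhoR N U).trace := by
  have hN' : (N : ℂ) ≠ 0 := by exact_mod_cast hN
  have h : (N : ℂ) ^ 4 * (rhoR N U * rhoR N U).trace =
      (reshuffle N U * (reshuffle N U)ᴴ * (reshuffle N U * (reshuffle N U)ᴴ)).trace := by
    simp only [rhoR, Matrix.smul_mul, Matrix.mul_smul, Matrix.trace_smul, smul_eq_mul]
    field_simp
  rw [h, trace_gram_sq, opA, trace_exchange_conj]
  refine (Fintype.sum_equiv (regroupR (Fin N)) _ _ fun x => ?_).symm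
  simp only [regroupR, exchangeA, reshuffle, Matrix.of_apply, Matrix.kroneckerMap_apply,
    Equiv.coe_fn_mk, Equiv.coe_fn_symm_mk, star_mul']
  ring

theorem swapGate_mul_swapGate : swapGate N * swapGate N = 1 := by
  ext p q
  simp [swapGate, Matrix.mul_apply, Matrix.one_apply, Fintype.sum_prod_type, ite_and, Prod.ext_iff]

theorem trace_opB_conj (hN : N ≠ 0) (U : Matrix (Fin N × Fin N) (Fin N × Fin N) ℂ) :
    (opB N * (U ⊗ₖ U) * opA N * (U ⊗ₖ U)ᴴ).trace = (N : ℂ) ^ 4 * (rhoT N U * rhoT N U).trace := by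
  have hN' : (N : ℂ) ≠ 0 := by exact_mod_cast hN
  have h : (N : ℂ) ^ 4 * (rhoT N U * rhoT N U).trace =
      (ptransp N U * (ptransp N U)ᴴ * (ptransp N U * (ptransp N U)ᴴ)).trace := by
    have h1 : swapGate N * (ptransp N U * (ptransp N U)ᴴ) * swapGate N *
        (swapGate N * (ptransp N U * (ptransp N U)ᴴ) * swapGate N) =
        swapGate N * (ptransp N U * (ptransp N U)ᴴ * (swapGate N * swapGate N) *
          (ptransp N U * (ptransp N U)ᴴ) * swapGate N) := by
      simp only [Matrix.mul_assoc]
    simp only [rhoT, Matrix.smul_mul, Matrix.mul_smul, Matrix.trace_smul, smul_eq_mul]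
    rw [h1, Matrix.trace_mul_comm, Matrix.mul_assoc, swapGate_mul_swapGate, Matrix.mul_one,
      Matrix.mul_one]
    field_simp
  rw [h, trace_gram_sq, opB, opA, trace_exchange_conj]
  refine (Fintype.sum_equiv (regroupT (Fin N)) _ _ fun x => ?_).symm
  simp only [regroupT, exchangeA, exchangeB, ptransp, Matrix.of_apply, Matrix.kroneckerMap_apply,
    Equiv.coe_fn_mk, Equiv.coe_fn_symm_mk, star_mul']
  ring

/-- The difference of the two partial exchange operators. -/
def opM (N : ℕ) : Matrix ((Fin N × Fin N) × (Fin N × Fin N)) ((Fin N × Fin N) × (Fin N × Fin N)) ℂ :=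
  opA N - opB N

/-- `1 - g_t` up to normalization, as a correlation function of exchange operators. -/
def exchangeCorr (U : Matrix (Fin N × Fin N) (Fin N × Fin N) ℂ) : ℂ :=
  (opM N * ((U ⊗ₖ U) * opA N * (U ⊗ₖ U)ᴴ)).trace

theorem gateTyp_eq (hN : 2 ≤ N) (U : Matrix (Fin N × Fin N) (Fin N × Fin N) ℂ) :
    gateTyp N U = 1 - (exchangeCorr U).re / ((N : ℝ) ^ 2 * ((N : ℝ) ^ 2 - 1)) := by
  have h1 : exchangeCorr U = ((N : ℝ) ^ 4 : ℝ) * ((rhoR N U * rhoR N U).trace -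
      (rhoT N U * rhoT N U).trace) := by
    push_cast
    rw [mul_sub, ← trace_opA_conj (by omega), ← trace_opB_conj (by omega), exchangeCorr, opM,
      Matrix.sub_mul, Matrix.trace_sub]
    simp only [Matrix.mul_assoc]
  have h2 : (2 : ℝ) ≤ N := by exact_mod_cast hN
  have h3 : (N : ℝ) ^ 2 - 1 ≠ 0 := by nlinarith
  rw [h1, Complex.re_ofReal_mul, Complex.sub_re, gateTyp, Xpur, Ypur]
  field_simp
  ring

theorem exchangeCorr_im (U : Matrix (Fin N × Fin N) (Fin N × Fin N) ℂ) :
    (exchangeCorr U).im = 0 := by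
  rw [← Complex.conj_eq_iff_im, ← Complex.star_def, exchangeCorr, ← Matrix.trace_conjTranspose,
    Matrix.conjTranspose_mul, Matrix.conjTranspose_mul, Matrix.conjTranspose_mul,
    Matrix.conjTranspose_conjTranspose, conjTranspose_opA, opM, Matrix.conjTranspose_sub,
    conjTranspose_opA, conjTranspose_opB, Matrix.trace_mul_comm, Matrix.mul_assoc]

end TwoCopies

section LocalCommutant

variable {N : ℕ}

/-- A single-factor operator acting on the first factor of the first copy. -/
def actA₁ (N : ℕ) : Matrix (Fin N) (Fin N) ℂ →ₗ[ℂ]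
    Matrix ((Fin N × Fin N) × (Fin N × Fin N)) ((Fin N × Fin N) × (Fin N × Fin N)) ℂ where
  toFun a := (a ⊗ₖ (1 : Matrix (Fin N) (Fin N) ℂ)) ⊗ₖ (1 : Matrix (Fin N × Fin N) (Fin N × Fin N) ℂ)
  map_add' a b := by simp only [Matrix.add_kronecker]
  map_smul' c a := by simp only [Matrix.smul_kronecker, RingHom.id_apply]

/-- A single-factor operator acting on the first factor of the second copy. -/
def actA₂ (N : ℕ) : Matrix (Fin N) (Fin N) ℂ →ₗ[ℂ]
    Matrix ((Fin N × Fin N) × (Fin N × Fin N)) ((Fin N × Fin N) × (Fin N × Fin N)) ℂ where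
  toFun a := (1 : Matrix (Fin N × Fin N) (Fin N × Fin N) ℂ) ⊗ₖ (a ⊗ₖ (1 : Matrix (Fin N) (Fin N) ℂ))
  map_add' a b := by simp only [Matrix.add_kronecker, Matrix.kronecker_add]
  map_smul' c a := by simp only [Matrix.smul_kronecker, Matrix.kronecker_smul, RingHom.id_apply]

/-- A single-factor operator acting on the second factor of the first copy. -/
def actB₁ (N : ℕ) : Matrix (Fin N) (Fin N) ℂ →ₗ[ℂ]
    Matrix ((Fin N × Fin N) × (Fin N × Fin N)) ((Fin N × Fin N) × (Fin N × Fin N)) ℂ where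
  toFun a := ((1 : Matrix (Fin N) (Fin N) ℂ) ⊗ₖ a) ⊗ₖ (1 : Matrix (Fin N × Fin N) (Fin N × Fin N) ℂ)
  map_add' a b := by simp only [Matrix.add_kronecker, Matrix.kronecker_add]
  map_smul' c a := by simp only [Matrix.smul_kronecker, Matrix.kronecker_smul, RingHom.id_apply]

/-- A single-factor operator acting on the second factor of the second copy. -/
def actB₂ (N : ℕ) : Matrix (Fin N) (Fin N) ℂ →ₗ[ℂ]
    Matrix ((Fin N × Fin N) × (Fin N × Fin N)) ((Fin N × Fin N) × (Fin N × Fin N)) ℂ where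
  toFun a := (1 : Matrix (Fin N × Fin N) (Fin N × Fin N) ℂ) ⊗ₖ ((1 : Matrix (Fin N) (Fin N) ℂ) ⊗ₖ a)
  map_add' a b := by simp only [Matrix.kronecker_add]
  map_smul' c a := by simp only [Matrix.kronecker_smul, RingHom.id_apply]

theorem commutesWithUnits_of_commute_local
    {P : Matrix ((Fin N × Fin N) × (Fin N × Fin N)) ((Fin N × Fin N) × (Fin N × Fin N)) ℂ}
    (h : ∀ a ∈ Matrix.unitaryGroup (Fin N) ℂ, ∀ b ∈ Matrix.unitaryGroup (Fin N) ℂ,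
      Commute P ((a ⊗ₖ b) ⊗ₖ (a ⊗ₖ b))) :
    (∀ α β γ δ, CommutesWithUnits fun i j k l => P ((i, α), (j, β)) ((k, γ), (l, δ))) ∧
      ∀ i j k l, CommutesWithUnits fun α β γ δ => P ((i, α), (j, β)) ((k, γ), (l, δ)) := by
  constructor
  · intro α β γ δ a b i j k l
    have h1 := commute_add_single (L := actA₁ N) (R := actA₂ N) (P := P) (by simp [actA₁])
      (by simp [actA₂]) (fun u hu => by
        simpa [actA₁, actA₂, ← Matrix.mul_kronecker_mul] using h u hu 1 (one_mem _)) a b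
    have h2 := congrFun (congrFun h1.eq ((i, α), (j, β))) ((k, γ), (l, δ))
    simp only [mul_add, add_mul, Matrix.add_apply] at h2
    simpa [Matrix.mul_apply, actA₁, actA₂, Fintype.sum_prod_type, Matrix.single_apply,
      Matrix.one_apply, Prod.ext_iff, ite_and, Finset.sum_ite_irrel, eq_comm (a := a)] using h2
  · intro i j k l a b α β γ δ
    have h1 := commute_add_single (L := actB₁ N) (R := actB₂ N) (P := P) (by simp [actB₁])
      (by simp [actB₂]) (fun u hu => by
        simpa [actB₁, actB₂, ← Matrix.mul_kronecker_mul] using h 1 (one_mem _) u hu) a b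
    have h2 := congrFun (congrFun h1.eq ((i, α), (j, β))) ((k, γ), (l, δ))
    simp only [mul_add, add_mul, Matrix.add_apply] at h2
    simpa [Matrix.mul_apply, actB₁, actB₂, Fintype.sum_prod_type, Matrix.single_apply,
      Matrix.one_apply, Prod.ext_iff, ite_and, Finset.sum_ite_irrel, eq_comm (a := a)] using h2

theorem exists_eq_of_commute_local (hN : 2 ≤ N)
    {P : Matrix ((Fin N × Fin N) × (Fin N × Fin N)) ((Fin N × Fin N) × (Fin N × Fin N)) ℂ}
    (h : ∀ a ∈ Matrix.unitaryGroup (Fin N) ℂ, ∀ b ∈ Matrix.unitaryGroup (Fin N) ℂ,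
      Commute P ((a ⊗ₖ b) ⊗ₖ (a ⊗ₖ b))) :
    ∃ x y z w : ℂ, P = x • 1 + y • opA N + z • opB N + w • opS N := by
  obtain ⟨hA, hB⟩ := commutesWithUnits_of_commute_local h
  choose X Y hXY using fun α β γ δ => (hA α β γ δ).exists_eq hN
  set i₀ : Fin N := ⟨0, by omega⟩
  set j₀ : Fin N := ⟨1, by omega⟩
  have hij : i₀ ≠ j₀ := by simp [i₀, j₀]
  have hX : CommutesWithUnits X := by
    convert hB i₀ j₀ i₀ j₀ using 1
    funext α β γ δ
    simp [hXY, hij]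
  have hY : CommutesWithUnits Y := by
    convert hB i₀ j₀ j₀ i₀ using 1
    funext α β γ δ
    simp [hXY, hij]
  obtain ⟨x, z, hx⟩ := hX.exists_eq hN
  obtain ⟨y, w, hy⟩ := hY.exists_eq hN
  refine ⟨x, y, z, w, ?_⟩
  ext ⟨⟨i, α⟩, ⟨j, β⟩⟩ ⟨⟨k, γ⟩, ⟨l, δ⟩⟩
  rw [hXY, hx, hy]
  simp only [Matrix.add_apply, Matrix.smul_apply, Matrix.one_apply, opA_apply, opB_apply,
    opS_apply, exchangeA, exchangeB, Equiv.coe_fn_mk, Prod.mk.injEq, Prod.swap_prod_mk,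
    smul_eq_mul, mul_ite, mul_one, mul_zero]
  simp only [ite_and]
  split_ifs <;> ring

end LocalCommutant

/-- The two-copy action of the local unitaries of `ℂ^N ⊗ ℂ^N`. -/
def localTwoCopies (N : ℕ) :
    Submonoid (Matrix ((Fin N × Fin N) × (Fin N × Fin N)) ((Fin N × Fin N) × (Fin N × Fin N)) ℂ) where
  carrier := {W | ∃ a ∈ Matrix.unitaryGroup (Fin N) ℂ, ∃ b ∈ Matrix.unitaryGroup (Fin N) ℂ,
    W = (a ⊗ₖ b) ⊗ₖ (a ⊗ₖ b)}
  one_mem' := ⟨1, one_mem _, 1, one_mem _, by simp⟩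
  mul_mem' := by
    rintro _ _ ⟨a, ha, b, hb, rfl⟩ ⟨a', ha', b', hb', rfl⟩
    exact ⟨a * a', mul_mem ha ha', b * b', mul_mem hb hb', by
      simp only [Matrix.mul_kronecker_mul]⟩

theorem conjTranspose_mul_self_kronecker {m n : Type*} [Fintype m] [DecidableEq m] [Fintype n]
    [DecidableEq n] {a : Matrix m m ℂ} {b : Matrix n n ℂ} (ha : aᴴ * a = 1) (hb : bᴴ * b = 1) :
    (a ⊗ₖ b)ᴴ * (a ⊗ₖ b) = 1 := by
  rw [Matrix.conjTranspose_kronecker, ← Matrix.mul_kronecker_mul, ha, hb, Matrix.one_kronecker_one]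

theorem conjTranspose_mul_self_of_mem_localTwoCopies {N : ℕ} {W} (hW : W ∈ localTwoCopies N) :
    Wᴴ * W = 1 := by
  obtain ⟨a, ha, b, hb, rfl⟩ := hW
  have h := conjTranspose_mul_self_kronecker (Matrix.mem_unitaryGroup_iff'.mp ha)
    (Matrix.mem_unitaryGroup_iff'.mp hb)
  exact conjTranspose_mul_self_kronecker h h

/-- The real part of `tr(A ·)`. -/
def reTraceMul {ι : Type*} [Fintype ι] (A : Matrix ι ι ℂ) : Matrix ι ι ℂ →ₗ[ℝ] ℝ where
  toFun B := (A * B).trace.re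
  map_add' B C := by rw [Matrix.mul_add, Matrix.trace_add, Complex.add_re]
  map_smul' c B := by
    rw [Matrix.mul_smul, Matrix.trace_smul, Complex.real_smul, Complex.re_ofReal_mul,
      RingHom.id_apply, smul_eq_mul]

/-- The infimum over interlacing local unitaries is at most the average, which is multiplicative. -/
theorem le_exchangeCorr_sq_div {N : ℕ} (hN : 2 ≤ N)
    {V : Matrix (Fin N × Fin N) (Fin N × Fin N) ℂ}
    (hV : V ∈ Matrix.unitaryGroup (Fin N × Fin N) ℂ) {c : ℝ}
    (hc : ∀ a ∈ Matrix.unitaryGroup (Fin N) ℂ, ∀ b ∈ Matrix.unitaryGroup (Fin N) ℂ,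
      c ≤ (exchangeCorr (V * (a ⊗ₖ b) * V)).re) :
    c ≤ (exchangeCorr V).re ^ 2 / ((N : ℝ) ^ 2 * ((N : ℝ) ^ 2 - 1)) := by
  set K := V ⊗ₖ V with hK
  have hKK : K * Kᴴ = 1 := by
    rw [hK, Matrix.conjTranspose_kronecker, ← Matrix.mul_kronecker_mul]
    have : V * Vᴴ = 1 := Matrix.mem_unitaryGroup_iff.mp hV
    rw [this, Matrix.one_kronecker_one]
  have hKS : K * opS N * Kᴴ = opS N := by
    rw [hK, ← opS_mul_kronecker_self, Matrix.mul_assoc, hKK, Matrix.mul_one]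
  have hMS : opM N * opS N = -opM N := by
    rw [opM, Matrix.sub_mul, opA_mul_opS, opB_mul_opS, neg_sub]
  have hM : (opM N).trace = 0 := by
    rw [opM, Matrix.trace_sub, trace_opA, trace_opB, sub_self]
  obtain ⟨P, hP, hf⟩ := exists_conj_invariant (localTwoCopies N)
    (fun W hW => conjTranspose_mul_self_of_mem_localTwoCopies hW) (K * opA N * Kᴴ)
  obtain ⟨x, y, z, w, hPeq⟩ := exists_eq_of_commute_local hN (P := P) (by
    intro a ha b hb
    have hW : (a ⊗ₖ b) ⊗ₖ (a ⊗ₖ b) ∈ localTwoCopies N := ⟨a, ha, b, hb, rfl⟩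
    have h1 := hP _ hW
    generalize (a ⊗ₖ b) ⊗ₖ (a ⊗ₖ b) = W at h1 hW
    rw [Commute, SemiconjBy]
    nth_rewrite 1 [← h1]
    rw [Matrix.mul_assoc, conjTranspose_mul_self_of_mem_localTwoCopies hW, Matrix.mul_one])
  have hinv : ∀ W ∈ localTwoCopies N, (opM N * (W * (K * opA N * Kᴴ) * Wᴴ)).trace =
      exchangeCorr V := by
    intro W hW
    have hWM : opM N * W = W * opM N := by
      obtain ⟨a, -, b, -, rfl⟩ := hW
      rw [opM, Matrix.sub_mul, Matrix.mul_sub, opA_mul_local, opB_mul_local]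
    rw [← Matrix.mul_assoc, ← Matrix.mul_assoc, Matrix.trace_mul_comm, hWM, Matrix.mul_assoc W,
      ← Matrix.mul_assoc, conjTranspose_mul_self_of_mem_localTwoCopies hW, Matrix.one_mul,
      exchangeCorr]
  have hMP : (opM N * P).trace.re = (exchangeCorr V).re := by
    refine le_antisymm ?_ ?_
    · have := hf (-reTraceMul (opM N)) (-(exchangeCorr V).re) fun W hW => by
        rw [← hinv W hW]; exact le_rfl
      exact neg_le_neg_iff.mp this
    · exact hf (reTraceMul (opM N)) (exchangeCorr V).re fun W hW => by
        rw [← hinv W hW]; exact le_rfl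
  have hMP' : (opM N * P).trace = (y - z) * ((N : ℂ) ^ 4 - (N : ℂ) ^ 2) := by
    have hMA : opM N * opA N = 1 - opS N := by
      rw [opM, Matrix.sub_mul, opA_mul_opA, opB_mul_opA]
    have hMB : opM N * opB N = opS N - 1 := by
      rw [opM, Matrix.sub_mul, opA_mul_opB, opB_mul_opB]
    rw [hPeq]
    simp only [Matrix.mul_add, Matrix.mul_smul, Matrix.trace_add, Matrix.trace_smul, hMA, hMB, hMS,
      Matrix.mul_one, hM, Matrix.trace_sub, Matrix.trace_neg, trace_opS, Matrix.trace_one,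
      Fintype.card_prod, Fintype.card_fin, smul_eq_mul]
    push_cast
    ring
  have hB : (opM N * (K * opB N * Kᴴ)).trace = -exchangeCorr V := by
    have h1 : K * opB N * Kᴴ = opS N * (K * opA N * Kᴴ) := by
      rw [← opS_mul_opA, ← Matrix.mul_assoc, ← Matrix.mul_assoc, ← Matrix.mul_assoc, hK,
        ← opS_mul_kronecker_self]
    rw [h1, ← Matrix.mul_assoc, hMS, Matrix.neg_mul, Matrix.trace_neg, exchangeCorr]
  have hval : (opM N * (K * P * Kᴴ)).trace = (y - z) * exchangeCorr V := by
    rw [hPeq]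
    simp only [Matrix.mul_add, Matrix.add_mul, Matrix.mul_smul, Matrix.smul_mul, Matrix.trace_add,
      Matrix.trace_smul, Matrix.mul_one, hKK, hKS, hMS, hM, hB, Matrix.trace_neg, smul_eq_mul]
    rw [hK, ← exchangeCorr]
    ring
  have hcP : c ≤ (opM N * (K * P * Kᴴ)).trace.re := by
    have hcyc : ∀ A, (opM N * (K * A * Kᴴ)).trace = (Kᴴ * opM N * K * A).trace := by
      intro A
      rw [← Matrix.mul_assoc, Matrix.trace_mul_comm]
      simp only [Matrix.mul_assoc]
    rw [hcyc]
    refine hf (reTraceMul (Kᴴ * opM N * K)) c fun W hW => ?_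
    obtain ⟨a, ha, b, hb, rfl⟩ := hW
    refine (hc a ha b hb).trans_eq ?_
    change _ = Complex.re (Matrix.trace (_ * _))
    rw [← hcyc, exchangeCorr, Matrix.mul_kronecker_mul, Matrix.mul_kronecker_mul, ← hK]
    simp only [Matrix.conjTranspose_mul, Matrix.mul_assoc]
  have h2 : (2 : ℝ) ≤ N := by exact_mod_cast hN
  have h3 : 0 < (N : ℝ) ^ 2 * ((N : ℝ) ^ 2 - 1) := by
    apply mul_pos <;> nlinarith
  have h4 : (exchangeCorr V).re = (y - z).re * ((N : ℝ) ^ 2 * ((N : ℝ) ^ 2 - 1)) := by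
    rw [← hMP, hMP', show (N : ℂ) ^ 4 - (N : ℂ) ^ 2 =
      (((N : ℝ) ^ 2 * ((N : ℝ) ^ 2 - 1) : ℝ) : ℂ) by push_cast; ring, Complex.re_mul_ofReal]
  rw [hval, Complex.mul_re, exchangeCorr_im, mul_zero, sub_zero] at hcP
  rw [le_div_iff₀ h3]
  calc c * _ ≤ _ := mul_le_mul_of_nonneg_right hcP h3.le
    _ = (exchangeCorr V).re ^ 2 := by rw [h4]; ring

/-- If `g_t(V²) < g_t(V)(2 - g_t(V))` for a unitary `V` on
`ℂ^N ⊗ ℂ^N`, then there exist local unitaries `U^A, U^B` on `ℂ^N` with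
`g_t(V²) < g_t(V (U^A ⊗ U^B) V)`. -/
theorem exists_local_increasing_gate_typicality (N : ℕ) (hN : 2 ≤ N)
    (V : Matrix (Fin N × Fin N) (Fin N × Fin N) ℂ)
    (hV : V ∈ Matrix.unitaryGroup (Fin N × Fin N) ℂ)
    (h : gateTyp N (V ^ 2) < gateTyp N V * (2 - gateTyp N V)) :
    ∃ UA UB : Matrix (Fin N) (Fin N) ℂ,
      UA ∈ Matrix.unitaryGroup (Fin N) ℂ ∧ UB ∈ Matrix.unitaryGroup (Fin N) ℂ ∧
        gateTyp N (V ^ 2) < gateTyp N (V * (UA ⊗ₖ UB) * V) := by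
  by_contra! hcon
  have h2 : (2 : ℝ) ≤ N := by exact_mod_cast hN
  have hD : 0 < (N : ℝ) ^ 2 * ((N : ℝ) ^ 2 - 1) := by
    apply mul_pos <;> nlinarith
  have hle := le_exchangeCorr_sq_div hN hV (c := (exchangeCorr (V ^ 2)).re) fun a ha b hb => by
    have h1 := hcon a b ha hb
    rw [gateTyp_eq hN, gateTyp_eq hN, sub_le_sub_iff_left] at h1
    exact (div_le_div_iff_of_pos_right hD).mp h1
  rw [gateTyp_eq hN, gateTyp_eq hN] at h
  rw [le_div_iff₀ hD] at hle
  have h3 : (exchangeCorr (V ^ 2)).re / ((N : ℝ) ^ 2 * ((N : ℝ) ^ 2 - 1)) ≤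
      ((exchangeCorr V).re / ((N : ℝ) ^ 2 * ((N : ℝ) ^ 2 - 1))) ^ 2 := by
    rw [div_pow, div_le_div_iff₀ hD (pow_pos hD 2)]
    nlinarith
  nlinarith
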